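/- arXiv:1207.5278 — 5 statements merged into one kernel-verified Lean document; each statement's English description precedes it below -/
import Mathlib

section
/- Let X be a locally compact Hausdorff topological space equipped with a continuous action of the multiplicative group ℝ₊ = {r ∈ ℝ : r > 0}. Let Y ⊆ X be an ℝ₊-simple subset, i.e., Y is locally closed and the action map induces a homeomorphism from ℝ₊ × Y (with the product topology) onto the set ℝ₊Y = {r • y : r > 0, y ∈ Y} with the topology induced from X. Then ℝ₊Y is a locally closed subset of X. -/
/-- The multiplicative group of positive real numbers. -/
abbrev PosReal : Type := {r : ℝ // 0 < r}

/-- A locally compact subspace of a Hausdorff space is locally closed. -/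
theorem Topology.IsEmbedding.isLocallyClosed_range {Z X : Type*} [TopologicalSpace Z]
    [TopologicalSpace X] [LocallyCompactSpace Z] [T2Space X] {f : Z → X}
    (hf : Topology.IsEmbedding f) : IsLocallyClosed (Set.range f) := by
  refine ((isLocallyClosed_tfae (Set.range f)).out 0 3).mpr ?_
  rintro _ ⟨z, rfl⟩
  obtain ⟨K, hK, hzK⟩ := exists_compact_mem_nhds z
  rw [hf.nhds_eq_comap, Filter.mem_comap] at hzK
  obtain ⟨V, hV, hVK⟩ := hzK
  obtain ⟨U, hUV, hU, hzU⟩ := mem_nhds_iff.mp hV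
  refine ⟨U, hzU, hU, ?_⟩
  have hsub : U ∩ Set.range f ⊆ f '' K := by
    rintro _ ⟨hwU, w, rfl⟩
    exact ⟨w, hVK (hUV hwU), rfl⟩
  calc U ∩ closure (Set.range f) ⊆ closure (U ∩ Set.range f) := hU.inter_closure
    _ ⊆ f '' K := closure_minimal hsub (hK.image hf.continuous).isClosed
    _ ⊆ Set.range f := Set.image_subset_range f K

/-- If `Y` is an `ℝ₊`-simple subset of a locally compact Hausdorff space `X`
equipped with a continuous action of the multiplicative group of positive reals
(i.e. `Y` is locally closed and the action map is a homeomorphism from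
`ℝ₊ × Y` onto `ℝ₊Y` with the induced topology), then `ℝ₊Y` is locally closed in `X`. -/
theorem rplus_simple_orbit_isLocallyClosed
    {X : Type*} [TopologicalSpace X] [T2Space X] [LocallyCompactSpace X]
    [MulAction PosReal X] [ContinuousSMul PosReal X]
    (Y : Set X) (hY : IsLocallyClosed Y)
    (hsimple : Topology.IsEmbedding (fun p : PosReal × Y => p.1 • (p.2 : X))) :
    IsLocallyClosed {x : X | ∃ (r : PosReal) (y : X), y ∈ Y ∧ r • y = x} := by
  have : LocallyCompactSpace Y := hY.locallyCompactSpace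
  have : LocallyCompactSpace PosReal :=
    (isOpen_Ioi (a := (0 : ℝ))).isLocallyClosed.locallyCompactSpace
  convert hsimple.isLocallyClosed_range using 1
  ext x
  simp only [Set.mem_ofPred_eq, Set.mem_range, Prod.exists, Subtype.exists, exists_prop]
end

section
/- Let A be a nonempty closed convex subset of a real normed vector space E. Let γ_A = {r • (x, −1) : r > 0, x ∈ A} ⊆ E × ℝ and let λ_A = {v ∈ E : a + t • v ∈ A for all a ∈ A and all t ≥ 0} be the asymptotic cone of A. Then the closure of γ_A in E × ℝ equals γ_A ∪ (λ_A × {0}); equivalently, λ_A × {0} = (closure of γ_A) ∩ (E × {0}). -/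
open Filter Topology

/-- If `r n • x n → v` with `x n ∈ A` and positive `r n → 0`, then `v` is a recession direction
of the closed convex set `A`. -/
theorem Convex.add_smul_mem_of_tendsto_smul
    {E : Type*} [NormedAddCommGroup E] [NormedSpace ℝ E] {A : Set E}
    (hconv : Convex ℝ A) (hA : IsClosed A) {r : ℕ → ℝ} {x : ℕ → E} {v : E}
    (hr : ∀ n, 0 < r n) (hx : ∀ n, x n ∈ A) (hr0 : Tendsto r atTop (𝓝 0))
    (hv : Tendsto (fun n => r n • x n) atTop (𝓝 v)) {a : E} (ha : a ∈ A) {t : ℝ} (ht : 0 ≤ t) :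
    a + t • v ∈ A := by
  have htr : Tendsto (fun n => t * r n) atTop (𝓝 0) := by
    simpa using hr0.const_mul t
  have hlim : Tendsto (fun n => (1 - t * r n) • a + (t * r n) • x n) atTop (𝓝 (a + t • v)) := by
    have h := ((htr.const_sub 1).smul_const a).add (hv.const_smul t)
    simpa [smul_smul] using h
  refine hA.mem_of_tendsto hlim ?_
  filter_upwards [htr.eventually_lt_const one_pos] with n hn
  exact hconv ha (hx n) (by linarith) (mul_nonneg ht (hr n).le) (by ring)


/-- Let `A` be a nonempty closed convex subset of a real normed vector space `E`,
`γ_A = {r • (x, -1) : r > 0, x ∈ A} ⊆ E × ℝ` its conification, and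
`λ_A` its asymptotic cone. Then `closure γ_A = γ_A ∪ (λ_A × {0})`. -/
theorem closure_conification_eq_union_asymptoticCone
    {E : Type*} [NormedAddCommGroup E] [NormedSpace ℝ E]
    (A : Set E) (hne : A.Nonempty) (hA : IsClosed A) (hconv : Convex ℝ A) :
    closure {p : E × ℝ | ∃ r : ℝ, 0 < r ∧ ∃ x ∈ A, p = r • (x, (-1 : ℝ))} =
      {p : E × ℝ | ∃ r : ℝ, 0 < r ∧ ∃ x ∈ A, p = r • (x, (-1 : ℝ))} ∪
        ({v : E | ∀ a ∈ A, ∀ t : ℝ, 0 ≤ t → a + t • v ∈ A} ×ˢ ({0} : Set ℝ)) := by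
  apply Set.Subset.antisymm
  · rintro ⟨v, s⟩ hp
    obtain ⟨u, hu, hlim⟩ := mem_closure_iff_seq_limit.1 hp
    choose r hr x hx hux using hu
    obtain rfl : u = fun n => r n • (x n, (-1 : ℝ)) := funext hux
    have hv : Tendsto (fun n => r n • x n) atTop (𝓝 v) := hlim.fst_nhds
    have hs : Tendsto r atTop (𝓝 (-s)) := by
      simpa using hlim.snd_nhds.neg
    have hs0 : 0 ≤ -s := ge_of_tendsto' hs fun n => (hr n).le
    rcases hs0.eq_or_lt with h0 | hpos
    · right
      rw [← h0] at hs
      exact ⟨fun a ha t ht => hconv.add_smul_mem_of_tendsto_smul hA hr hx hs hv ha ht,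
        neg_eq_zero.1 h0.symm⟩
    · left
      refine ⟨-s, hpos, (-s)⁻¹ • v, ?_, ?_⟩
      · refine hA.mem_of_tendsto ((hs.inv₀ hpos.ne').smul hv) (Eventually.of_forall fun n => ?_)
        simpa [smul_smul, (hr n).ne'] using hx n
      · rw [Prod.smul_mk, smul_inv_smul₀ hpos.ne']
        simp
  · refine Set.union_subset subset_closure ?_
    rintro ⟨v, s⟩ ⟨hv, rfl : s = 0⟩
    obtain ⟨a, ha⟩ := hne
    have hlim : Tendsto (fun r : ℝ => (r • a + v, -r)) (𝓝[>] 0) (𝓝 (v, 0)) := by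
      have hcont : Continuous fun r : ℝ => (r • a + v, -r) := by fun_prop
      simpa using (hcont.tendsto 0).mono_left nhdsWithin_le_nhds
    refine mem_closure_of_tendsto hlim ?_
    filter_upwards [self_mem_nhdsWithin] with r hr
    have hr : 0 < r := hr
    refine ⟨r, hr, a + r⁻¹ • v, hv a ha _ (inv_nonneg.2 hr.le), ?_⟩
    simp [smul_smul, hr.ne']
end

section
/- Let A be a nonempty closed convex subset of a real normed vector space E, and let γ_A = {r • (x, −1) : r > 0, x ∈ A} ⊆ E × ℝ. Then the closure of γ_A is a proper cone (i.e., for every z ∈ E × ℝ, if both z and −z lie in the closure of γ_A then z = 0) if and only if A contains no affine line (i.e., there exist no a ∈ E and v ∈ E with v ≠ 0 such that a + t • v ∈ A for all t ∈ ℝ). -/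
/-- If `(v, 0)` lies in the closure of the conification of a closed convex set `A`, then `v` is a
recession direction of `A`. -/
theorem add_smul_mem_of_mem_closure_conification
    {E : Type*} [NormedAddCommGroup E] [NormedSpace ℝ E]
    {A : Set E} (hA : IsClosed A) (hconv : Convex ℝ A) {v : E}
    (hv : (v, (0 : ℝ)) ∈
      closure {p : E × ℝ | ∃ r : ℝ, 0 < r ∧ ∃ x ∈ A, p = r • (x, (-1 : ℝ))})
    {a : E} (ha : a ∈ A) {t : ℝ} (ht : 0 ≤ t) : a + t • v ∈ A := by
  have hcont : ContinuousAt (fun p : E × ℝ => (1 - t * p.2)⁻¹ • (a + t • p.1)) (v, 0) := by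
    refine ContinuousAt.smul (ContinuousAt.inv₀ (by fun_prop) (by simp)) (by fun_prop)
  have hmem := hcont.continuousWithinAt.mem_closure (t := A) hv ?_
  · rw [hA.closure_eq] at hmem
    simpa using hmem
  · rintro _ ⟨r, hr, x, hx, rfl⟩
    have hpos : 0 < 1 + t * r := by positivity
    have key := hconv ha hx (a := (1 + t * r)⁻¹) (b := (1 + t * r)⁻¹ * (t * r))
      (by positivity) (by positivity) (by field_simp)
    convert key using 1
    simp [smul_smul, smul_add]

theorem snd_nonpos_of_mem_closure_conification
    {E : Type*} [NormedAddCommGroup E] [NormedSpace ℝ E] {A : Set E} {z : E × ℝ}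
    (hz : z ∈ closure {p : E × ℝ | ∃ r : ℝ, 0 < r ∧ ∃ x ∈ A, p = r • (x, (-1 : ℝ))}) :
    z.2 ≤ 0 := by
  refine closure_minimal (t := {p : E × ℝ | p.2 ≤ 0}) ?_
    (isClosed_le continuous_snd continuous_const) hz
  rintro _ ⟨r, hr, x, -, rfl⟩
  simpa using hr.le

theorem mem_closure_conification_of_ray
    {E : Type*} [NormedAddCommGroup E] [NormedSpace ℝ E] {A : Set E} {a v : E}
    (h : ∀ t : ℝ, 0 < t → a + t • v ∈ A) :
    (v, (0 : ℝ)) ∈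
      closure {p : E × ℝ | ∃ r : ℝ, 0 < r ∧ ∃ x ∈ A, p = r • (x, (-1 : ℝ))} := by
  have hcont : Continuous (fun r : ℝ => (r • a + v, -r)) := by fun_prop
  have hmem := hcont.continuousWithinAt.mem_closure (s := Set.Ioi 0) (x := 0)
    (t := {p : E × ℝ | ∃ r : ℝ, 0 < r ∧ ∃ x ∈ A, p = r • (x, (-1 : ℝ))})
    (by simp [closure_Ioi]) ?_
  · simpa using hmem
  · intro r hr
    have hr : 0 < r := hr
    refine ⟨r, hr, a + r⁻¹ • v, h _ (by positivity), ?_⟩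
    simp [smul_smul, hr.ne']

/-- Let `A` be a nonempty closed convex subset of a real normed vector space `E` and
`γ_A = {r • (x, -1) : r > 0, x ∈ A} ⊆ E × ℝ` its conification. Then the closure of `γ_A`
is a proper cone (contains no pair of nonzero antipodal points) if and only if `A`
contains no affine line. -/
theorem closure_conification_proper_iff_no_affine_line
    {E : Type*} [NormedAddCommGroup E] [NormedSpace ℝ E]
    (A : Set E) (hne : A.Nonempty) (hA : IsClosed A) (hconv : Convex ℝ A) :
    (∀ z : E × ℝ,
        z ∈ closure {p : E × ℝ | ∃ r : ℝ, 0 < r ∧ ∃ x ∈ A, p = r • (x, (-1 : ℝ))} →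
        -z ∈ closure {p : E × ℝ | ∃ r : ℝ, 0 < r ∧ ∃ x ∈ A, p = r • (x, (-1 : ℝ))} →
        z = 0) ↔
      ¬ ∃ (a v : E), v ≠ 0 ∧ ∀ t : ℝ, a + t • v ∈ A := by
  constructor
  · rintro h ⟨a, v, hv, hline⟩
    have hpos := mem_closure_conification_of_ray (fun t _ => hline t)
    have hneg := mem_closure_conification_of_ray (A := A) (a := a) (v := -v)
      (fun t _ => by simpa using hline (-t))
    exact hv (congrArg Prod.fst (h (v, 0) hpos (by simpa using hneg)))
  · rintro h ⟨v, s⟩ hz hz'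
    have hs : s ≤ 0 := snd_nonpos_of_mem_closure_conification hz
    have hs' : -s ≤ 0 := snd_nonpos_of_mem_closure_conification hz'
    obtain rfl : s = 0 := by linarith
    obtain ⟨a, ha⟩ := hne
    by_contra hv
    refine h ⟨a, v, fun h0 => hv (by simp [h0]), fun t => ?_⟩
    rcases le_total 0 t with ht | ht
    · exact add_smul_mem_of_mem_closure_conification hA hconv hz ha ht
    · have hneg := add_smul_mem_of_mem_closure_conification hA hconv (v := -v)
        (by simpa using hz') ha (neg_nonneg.2 ht)
      simpa using hneg
end

section
/- For every natural number m there exists a constant c > 0 such that for all real numbers f, γ, s satisfying −2 < f + γ < −1 and s < −f, one has e^s · |∫_γ^s e^{−u} / |u + f|^{m+1} du| ≤ c · (1 + 1/|s + f|^{m+1}). (Note that under these hypotheses u + f < 0 for every u in the interval between γ and s, so the integrand is continuous there.) -/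
/-- For every natural number `m` there is a constant `c > 0` such that for all real
`f`, `γ`, `s` with `-2 < f + γ < -1` and `s < -f` one has
`e^s · |∫_γ^s e^{-u} / |u + f|^{m+1} du| ≤ c · (1 + 1/|s + f|^{m+1})`. -/
theorem exp_mul_intervalIntegral_exp_div_abs_pow_le
    (m : ℕ) :
    ∃ c : ℝ, 0 < c ∧ ∀ f γ s : ℝ, -2 < f + γ → f + γ < -1 → s < -f →
      Real.exp s * |∫ u in γ..s, Real.exp (-u) / |u + f| ^ (m + 1)| ≤
        c * (1 + 1 / |s + f| ^ (m + 1)) := by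
  refine ⟨Real.exp 2, Real.exp_pos 2, fun f γ s h₁ h₂ hs => ?_⟩
  set K : ℝ := 1 + 1 / |s + f| ^ (m + 1)
  have hsf : 0 < |s + f| := abs_pos.2 (by linarith)
  have hK0 : 0 ≤ K := by positivity
  have hbound : ∀ u ∈ Set.uIoc γ s,
      ‖Real.exp (-u) / |u + f| ^ (m + 1)‖ ≤ K * Real.exp (-u) := by
    intro u hu
    rw [Real.norm_of_nonneg (by positivity), div_eq_inv_mul, ← one_div]
    refine mul_le_mul_of_nonneg_right ?_ (Real.exp_pos _).le
    rcases Set.mem_uIoc.1 hu with h | h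
    · have hle : |s + f| ≤ |u + f| := by
        rw [abs_of_neg (by linarith : s + f < 0), abs_of_neg (by linarith [h.2] : u + f < 0)]
        linarith [h.2]
      have : 1 / |u + f| ^ (m + 1) ≤ 1 / |s + f| ^ (m + 1) := by gcongr
      linarith
    · have hle : 1 ≤ |u + f| := by
        rw [abs_of_neg (by linarith [h.2] : u + f < 0)]
        linarith [h.2]
      have : 1 / |u + f| ^ (m + 1) ≤ 1 :=
        div_le_one_of_le₀ (one_le_pow₀ hle) (by positivity)
      have : 0 ≤ 1 / |s + f| ^ (m + 1) := by positivity
      linarith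
  have hint : ∫ u in γ..s, K * Real.exp (-u) = K * (Real.exp (-γ) - Real.exp (-s)) := by
    rw [intervalIntegral.integral_const_mul,
      intervalIntegral.integral_comp_neg (fun u => Real.exp u), integral_exp]
  have hle : |∫ u in γ..s, Real.exp (-u) / |u + f| ^ (m + 1)| ≤
      |∫ u in γ..s, K * Real.exp (-u)| :=
    intervalIntegral.norm_integral_le_abs_of_norm_le
      ((MeasureTheory.ae_restrict_mem measurableSet_uIoc).mono hbound)
      (Continuous.intervalIntegrable (by fun_prop) _ _)
  have hexp : |Real.exp (s - γ) - 1| ≤ Real.exp 2 := by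
    have h₃ : Real.exp (s - γ) ≤ Real.exp 2 := Real.exp_le_exp.2 (by linarith)
    have h₄ : 1 ≤ Real.exp 2 := Real.one_le_exp (by norm_num)
    have h₅ := Real.exp_pos (s - γ)
    exact abs_le.2 ⟨by linarith, by linarith⟩
  calc Real.exp s * |∫ u in γ..s, Real.exp (-u) / |u + f| ^ (m + 1)|
      ≤ Real.exp s * |K * (Real.exp (-γ) - Real.exp (-s))| := by
        rw [← hint]
        gcongr
    _ = |Real.exp (s - γ) - 1| * K := by
        rw [← abs_of_pos (Real.exp_pos s), ← abs_mul,
          mul_left_comm, mul_sub, ← Real.exp_add, ← Real.exp_add, add_neg_cancel,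
          Real.exp_zero, ← sub_eq_add_neg, abs_mul, abs_of_nonneg hK0, mul_comm]
    _ ≤ Real.exp 2 * K := by gcongr
end

section
/- For all natural numbers m and m' there exist a constant c > 0 and a natural number N such that for all real numbers f, γ, s satisfying −2 < f + γ < −1 and s < −f, one has e^s · |∫_γ^s |u|^m e^{−u} / |u + f|^{m'} du| ≤ c · (1 + |s| + |f| + 1/|s + f|)^N. (This is the pointwise form of the statement that the function (x, s) ↦ e^s ∫_{γ(x)}^s |u|^m e^{−u} |u + f(x)|^{−m'} du has polynomial growth.) -/
/-- For all natural numbers `m`, `m'` there are a constant `c > 0` and an exponent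
`N ∈ ℕ` such that for all real `f`, `γ`, `s` with `-2 < f + γ < -1` and `s < -f` one has
`e^s · |∫_γ^s |u|^m e^{-u} / |u + f|^{m'} du| ≤ c · (1 + |s| + |f| + 1/|s + f|)^N`.
This is the pointwise form of the polynomial growth estimate of Lemma `est`. -/
theorem exp_mul_intervalIntegral_abs_pow_exp_div_abs_pow_le
    (m m' : ℕ) :
    ∃ c : ℝ, 0 < c ∧ ∃ N : ℕ, ∀ f γ s : ℝ, -2 < f + γ → f + γ < -1 → s < -f →
      Real.exp s * |∫ u in γ..s, |u| ^ m * Real.exp (-u) / |u + f| ^ m'| ≤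
        c * (1 + |s| + |f| + 1 / |s + f|) ^ N := by
  refine ⟨Real.exp 2 * 2 ^ (m + 1), by positivity, m + m' + 1, fun f γ s h₁ h₂ hs => ?_⟩
  set A : ℝ := 1 + |s| + |f| + 1 / |s + f| with hA
  have hsf : 0 < |s + f| := abs_pos.mpr (by linarith)
  have hinv : 0 < 1 / |s + f| := by positivity
  have hs0 := abs_nonneg s
  have hf0 := abs_nonneg f
  have hA1 : 1 ≤ A := by linarith
  have hγ : |γ| ≤ |f| + 2 := by
    rw [abs_le]
    constructor <;> linarith [neg_abs_le f, le_abs_self f]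
  have hbound : ∀ u ∈ Set.uIoc γ s,
      ‖|u| ^ m * Real.exp (-u) / |u + f| ^ m'‖ ≤ (2 * A) ^ m * Real.exp (2 - s) * A ^ m' := by
    intro u hu
    have hu' := Set.uIoc_subset_uIcc hu
    rw [Set.mem_uIcc] at hu'
    have hu_abs : |u| ≤ 2 * A := by
      have hmax : |u| ≤ |γ| + |s| := by
        rw [abs_le]
        rcases hu' with h | h <;> constructor <;>
          linarith [neg_abs_le γ, le_abs_self γ, neg_abs_le s, le_abs_self s,
            abs_nonneg γ]
      linarith
    have hexp : Real.exp (-u) ≤ Real.exp (2 - s) :=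
      Real.exp_le_exp.mpr (by rcases hu' with h | h <;> linarith)
    have hdist : |u + f|⁻¹ ≤ A := by
      rcases hu' with h | h
      · have hle : |s + f| ≤ |u + f| := by
          rw [abs_of_neg (by linarith), abs_of_neg (by linarith)]
          linarith
        have := one_div_le_one_div_of_le hsf hle
        rw [← one_div]
        linarith
      · have hle : 1 ≤ |u + f| := by
          rw [abs_of_neg (by linarith)]
          linarith
        exact (inv_le_one_of_one_le₀ hle).trans hA1
    rw [Real.norm_of_nonneg (by positivity), div_eq_mul_inv, ← inv_pow]
    gcongr
  have hlen : |s - γ| ≤ 2 * A := by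
    linarith [abs_sub s γ]
  have hint := intervalIntegral.norm_integral_le_of_norm_le_const hbound
  rw [Real.norm_eq_abs] at hint
  calc
    _ ≤ Real.exp s * ((2 * A) ^ m * Real.exp (2 - s) * A ^ m' * (2 * A)) := by
      gcongr
      exact hint.trans (by gcongr)
    _ = Real.exp 2 * 2 ^ (m + 1) * A ^ (m + m' + 1) := by
      rw [Real.exp_sub, mul_pow]
      field_simp
      ring
end
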